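/- Fix δ ∈ (0,1) and εmax ∈ (0,1/2). There exist a constant C > 0 and an integer N ≥ 1, both depending only on δ and εmax, such that for every n ≥ N and every σ > 0 there exists a confidence-interval procedure (l,u) on n samples (which may depend on n, σ, δ, εmax) with the following property: for every θ ∈ ℝ, every ε ∈ [0, εmax], and every probability measure Q on ℝ, letting r̄ = C·σ·( n^{-1/4} + ε^{1/2} / √(max(1, log(e·n·ε²))) ) (with the convention that the second summand is 0 when ε = 0), one has P_{θ,σ,ε,Q}^{⊗n}( { x ∈ ℝⁿ : l(x) ≤ θ ≤ u(x) and u(x) − l(x) ≤ r̄ } ) ≥ 1 − δ. -/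

import Mathlib

open MeasureTheory ProbabilityTheory Real
open scoped ENNReal NNReal

/-- Gaussian measure on `ℝ` with mean `m` and variance `v`. -/
noncomputable def gauss (m v : ℝ) : Measure ℝ := gaussianReal m (Real.toNNReal v)

/-- Efron's Gaussian two-groups model:
`(1-ε)·N(θ,σ²) + ε·(Q ∗ N(0,σ²))`. -/
noncomputable def efron (θ σ ε : ℝ) (Q : Measure ℝ) : Measure ℝ :=
  (ENNReal.ofReal (1 - ε)) • gauss θ (σ ^ 2) +
    (ENNReal.ofReal ε) • (Measure.conv Q (gauss 0 (σ ^ 2)))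

/-- The `n`-fold product (i.i.d.) measure on `ℝⁿ`. -/
noncomputable def iid (n : ℕ) (P : Measure ℝ) : Measure (Fin n → ℝ) :=
  Measure.pi fun _ => P

instance (m v : ℝ) : IsProbabilityMeasure (gauss m v) := by unfold gauss; infer_instance

instance (n : ℕ) (P : Measure ℝ) [IsProbabilityMeasure P] : IsProbabilityMeasure (iid n P) := by
  unfold iid; infer_instance

lemma isProbabilityMeasure_efron {ε : ℝ} (θ σ : ℝ) (hε : ε ∈ Set.Icc (0 : ℝ) 1) (Q : Measure ℝ)
    [IsProbabilityMeasure Q] : IsProbabilityMeasure (efron θ σ ε Q) := by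
  refine ⟨?_⟩
  simp only [efron, Measure.add_apply, Measure.smul_apply, measure_univ, smul_eq_mul, mul_one]
  rw [← ENNReal.ofReal_add (by linarith [hε.2]) hε.1]
  simp

lemma integrable_cexp_mul (P : Measure ℝ) [IsFiniteMeasure P] (s : ℝ) :
    Integrable (fun x : ℝ => Complex.exp (s * x * Complex.I)) P := by
  refine (integrable_const (1 : ℝ)).mono' (by fun_prop) (ae_of_all _ fun x => ?_)
  rw [← Complex.ofReal_mul, Complex.norm_exp_ofReal_mul_I]

/-- The characteristic function of the mixing measure `(1-ε)·δ_θ + ε·Q`. -/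
noncomputable def mixCharFun (θ ε : ℝ) (Q : Measure ℝ) (s : ℝ) : ℂ :=
  (1 - ε) * Complex.exp (s * θ * Complex.I) + ε * charFun Q s

lemma charFun_efron {θ σ ε : ℝ} (hε : ε ∈ Set.Icc (0 : ℝ) 1) (Q : Measure ℝ)
    [IsProbabilityMeasure Q] (s : ℝ) :
    charFun (efron θ σ ε Q) s = Real.exp (-(σ ^ 2 * s ^ 2 / 2)) * mixCharFun θ ε Q s := by
  have hadd : charFun (efron θ σ ε Q) s =
      (1 - ε) * charFun (gauss θ (σ ^ 2)) s + ε * charFun (Measure.conv Q (gauss 0 (σ ^ 2))) s := by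
    rw [charFun_apply_real, efron, integral_add_measure
      ((integrable_cexp_mul _ s).smul_measure ENNReal.ofReal_ne_top) ((integrable_cexp_mul _ s).smul_measure ENNReal.ofReal_ne_top),
      integral_smul_measure, integral_smul_measure, ← charFun_apply_real, ← charFun_apply_real,
      ENNReal.toReal_ofReal (by linarith [hε.2]), ENNReal.toReal_ofReal hε.1]
    simp
  rw [hadd, charFun_conv, mixCharFun]
  simp only [gauss, charFun_gaussianReal, Real.coe_toNNReal _ (sq_nonneg σ)]
  simp only [sub_eq_add_neg, Complex.exp_add]
  push_cast
  simp only [mul_zero, zero_mul, Complex.exp_zero]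
  ring

/-- Chebyshev's inequality for the empirical mean of a function bounded by one. -/
lemma iid_mean_deviation {n : ℕ} (hn : 0 < n) (P : Measure ℝ) [IsProbabilityMeasure P]
    {f : ℝ → ℝ} (hf : Measurable f) (hb : ∀ x, |f x| ≤ 1) {c : ℝ} (hc : 0 < c) :
    iid n P {x | c ≤ |(∑ i, f (x i)) / n - ∫ y, f y ∂P|} ≤ ENNReal.ofReal (1 / (n * c ^ 2)) := by
  have hn' : (0 : ℝ) < n := by exact_mod_cast hn
  have hmem : MemLp f 2 P :=
    MemLp.of_bound hf.aestronglyMeasurable 1 (ae_of_all _ fun x => by simpa using hb x)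
  have hmemi : ∀ i : Fin n, MemLp (fun x : Fin n → ℝ => f (x i)) 2 (iid n P) := fun i =>
    MemLp.of_bound (hf.comp (measurable_pi_apply i)).aestronglyMeasurable 1
      (ae_of_all _ fun x => by simpa using hb (x i))
  have hS : MemLp (∑ i : Fin n, fun x : Fin n → ℝ => f (x i)) 2 (iid n P) :=
    memLp_finsetSum' _ fun i _ => hmemi i
  have hvar : Var[∑ i : Fin n, fun x : Fin n → ℝ => f (x i); iid n P] ≤ n := by
    have h := variance_sum_pi (μ := fun _ : Fin n => P) (X := fun _ => f) fun _ => hmem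
    rw [iid, h]
    have h1 : Var[f; P] ≤ 1 := by
      refine (variance_le_expectation_sq hmem.aestronglyMeasurable).trans ?_
      calc ∫ x, (f ^ 2) x ∂P ≤ ∫ _, (1 : ℝ) ∂P := by
            refine integral_mono hmem.integrable_sq (integrable_const _) fun x => ?_
            simpa using hb x
        _ = 1 := by simp
    simpa using Finset.sum_le_card_nsmul Finset.univ (fun _ : Fin n => Var[f; P]) 1 fun _ _ => h1
  have hmean : ∫ x, (∑ i : Fin n, fun x : Fin n → ℝ => f (x i)) x ∂(iid n P)
      = n * ∫ y, f y ∂P := by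
    simp only [Finset.sum_apply]
    rw [integral_finsetSum _ fun i _ => (hmemi i).integrable (by norm_num)]
    have : ∀ i : Fin n, ∫ x, f (x i) ∂(iid n P) = ∫ y, f y ∂P := fun i =>
      integral_comp_eval (μ := fun _ : Fin n => P) hf.aestronglyMeasurable
    simp [this]
  have hcheb := meas_ge_le_variance_div_sq hS (mul_pos hn' hc)
  rw [hmean] at hcheb
  refine (measure_mono fun x hx => ?_).trans (hcheb.trans (ENNReal.ofReal_le_ofReal ?_))
  · simp only [Set.mem_ofPred_eq, Finset.sum_apply] at hx ⊢
    have : (∑ i, f (x i)) - n * ∫ y, f y ∂P = n * ((∑ i, f (x i)) / n - ∫ y, f y ∂P) := by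
      field_simp
    rw [this, abs_mul, abs_of_pos hn']
    gcongr
  · calc _ ≤ (n : ℝ) / (n * c) ^ 2 := by gcongr
      _ = _ := by field_simp

/-- Empirical characteristic function. -/
noncomputable def empCharFun {n : ℕ} (s : ℝ) (x : Fin n → ℝ) : ℂ :=
  (∑ i, Complex.exp (s * x i * Complex.I)) / n

lemma measurable_empCharFun {n : ℕ} (s : ℝ) : Measurable (empCharFun (n := n) s) := by
  unfold empCharFun; fun_prop

lemma re_charFun (P : Measure ℝ) [IsFiniteMeasure P] (s : ℝ) :
    (charFun P s).re = ∫ y, Real.cos (s * y) ∂P := by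
  rw [charFun_apply_real, ← RCLike.re_eq_complex_re, ← integral_re (integrable_cexp_mul P s)]
  refine integral_congr_ae (ae_of_all _ fun y => ?_)
  simp only [RCLike.re_eq_complex_re, ← Complex.ofReal_mul, Complex.exp_ofReal_mul_I_re]

lemma im_charFun (P : Measure ℝ) [IsFiniteMeasure P] (s : ℝ) :
    (charFun P s).im = ∫ y, Real.sin (s * y) ∂P := by
  rw [charFun_apply_real, ← RCLike.im_eq_complex_im, ← integral_im (integrable_cexp_mul P s)]
  refine integral_congr_ae (ae_of_all _ fun y => ?_)
  simp only [RCLike.im_eq_complex_im, ← Complex.ofReal_mul, Complex.exp_ofReal_mul_I_im]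

lemma re_empCharFun {n : ℕ} (s : ℝ) (x : Fin n → ℝ) :
    (empCharFun s x).re = (∑ i, Real.cos (s * x i)) / n := by
  simp only [empCharFun, Complex.div_natCast_re, Complex.re_sum, ← Complex.ofReal_mul,
    Complex.exp_ofReal_mul_I_re]

lemma im_empCharFun {n : ℕ} (s : ℝ) (x : Fin n → ℝ) :
    (empCharFun s x).im = (∑ i, Real.sin (s * x i)) / n := by
  simp only [empCharFun, Complex.div_natCast_im, Complex.im_sum, ← Complex.ofReal_mul,
    Complex.exp_ofReal_mul_I_im]

lemma empCharFun_deviation {n : ℕ} (hn : 0 < n) (P : Measure ℝ) [IsProbabilityMeasure P]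
    (s : ℝ) {c : ℝ} (hc : 0 < c) :
    iid n P {x | c ≤ ‖empCharFun s x - charFun P s‖} ≤ ENNReal.ofReal (8 / (n * c ^ 2)) := by
  have hn' : (0 : ℝ) < n := by exact_mod_cast hn
  have hc2 : 0 < c / 2 := by positivity
  have h1 := iid_mean_deviation hn P (f := fun y => Real.cos (s * y)) (by fun_prop)
    (fun x => Real.abs_cos_le_one _) hc2
  have h2 := iid_mean_deviation hn P (f := fun y => Real.sin (s * y)) (by fun_prop)
    (fun x => Real.abs_sin_le_one _) hc2
  simp only [← re_charFun, ← im_charFun, ← re_empCharFun, ← im_empCharFun, ← Complex.sub_re,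
    ← Complex.sub_im] at h1 h2
  have hsub : {x : Fin n → ℝ | c ≤ ‖empCharFun s x - charFun P s‖} ⊆
      {x | c / 2 ≤ |(empCharFun s x - charFun P s).re|} ∪
        {x | c / 2 ≤ |(empCharFun s x - charFun P s).im|} := by
    intro x hx
    have hx' := le_trans (Set.mem_ofPred_eq ▸ hx) (Complex.norm_le_abs_re_add_abs_im _)
    rcases le_or_gt (c / 2) |(empCharFun s x - charFun P s).re| with h | h
    · exact Or.inl h
    · refine Or.inr (show c / 2 ≤ _ from ?_)
      linarith
  have hsum : ENNReal.ofReal (1 / (n * (c / 2) ^ 2)) + ENNReal.ofReal (1 / (n * (c / 2) ^ 2))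
      = ENNReal.ofReal (8 / (n * c ^ 2)) := by
    rw [← ENNReal.ofReal_add (by positivity) (by positivity)]
    congr 1
    field_simp
    norm_num
  rw [← hsum]
  exact (measure_mono hsub).trans ((measure_union_le _ _).trans (add_le_add h1 h2))

/-- Fraction of the sample within distance `r` of `a`. -/
noncomputable def fracNear {n : ℕ} (a r : ℝ) (x : Fin n → ℝ) : ℝ :=
  (∑ i, (Set.Icc (a - r) (a + r)).indicator (fun _ => (1 : ℝ)) (x i)) / n

lemma measurable_fracNear {n : ℕ} (a r : ℝ) : Measurable (fracNear (n := n) a r) := by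
  have h : Measurable ((Set.Icc (a - r) (a + r)).indicator fun _ => (1 : ℝ)) :=
    measurable_const.indicator measurableSet_Icc
  exact (Finset.measurable_sum _ fun i _ => h.comp (measurable_pi_apply i)).div_const _

lemma fracNear_mono {n : ℕ} {a b r r' : ℝ} (h : |a - b| + r ≤ r') (x : Fin n → ℝ) :
    fracNear a r x ≤ fracNear b r' x := by
  unfold fracNear
  refine div_le_div_of_nonneg_right (Finset.sum_le_sum fun i _ => ?_) n.cast_nonneg
  refine Set.indicator_le_indicator_of_subset (Set.Icc_subset_Icc ?_ ?_)
    (fun _ => zero_le_one' ℝ) _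
  · linarith [(abs_le.1 (le_refl |a - b|)).1]
  · linarith [(abs_le.1 (le_refl |a - b|)).2]

lemma abs_sub_le_of_half_lt_fracNear {n : ℕ} {a b r r' : ℝ} {x : Fin n → ℝ}
    (ha : 1 / 2 < fracNear a r x) (hb : 1 / 2 < fracNear b r' x) : |a - b| ≤ r + r' := by
  by_contra! hab
  have hn : (0 : ℝ) < n := by
    rcases Nat.eq_zero_or_pos n with rfl | h
    · norm_num [fracNear] at ha
    · exact_mod_cast h
  have hle : fracNear a r x + fracNear b r' x ≤ 1 := by
    rw [fracNear, fracNear, ← add_div, div_le_one hn, ← Finset.sum_add_distrib]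
    refine (Finset.sum_le_card_nsmul Finset.univ _ 1 fun i _ => ?_).trans (by simp)
    simp only [Set.indicator_apply, Set.mem_Icc]
    split_ifs with h1 h2 <;> norm_num
    rcases lt_abs.1 hab with h | h <;> linarith [h1.1, h1.2, h2.1, h2.2]
  linarith

lemma efron_Icc_ge {θ σ ε M : ℝ} (hσ : 0 < σ) (hM : 0 < M) (hε : ε ∈ Set.Icc (0 : ℝ) 1)
    (Q : Measure ℝ) [IsProbabilityMeasure Q] :
    (1 - ε) * (1 - 1 / M ^ 2) ≤ (efron θ σ ε Q).real (Set.Icc (θ - M * σ) (θ + M * σ)) := by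
  have := isProbabilityMeasure_efron θ σ hε Q
  set A := Set.Icc (θ - M * σ) (θ + M * σ) with hA
  have hg : 1 - 1 / M ^ 2 ≤ (gauss θ (σ ^ 2)).real A := by
    have hcheb : gauss θ (σ ^ 2) {x | M * σ ≤ |id x - ∫ y, id y ∂(gauss θ (σ ^ 2))|}
        ≤ ENNReal.ofReal (Var[id; gauss θ (σ ^ 2)] / (M * σ) ^ 2) :=
      meas_ge_le_variance_div_sq (memLp_id_gaussianReal 2) (mul_pos hM hσ)
    have h1 : Var[id; gauss θ (σ ^ 2)] / (M * σ) ^ 2 = 1 / M ^ 2 := by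
      rw [gauss, variance_id_gaussianReal, Real.coe_toNNReal _ (sq_nonneg σ)]
      field_simp
    have h2 : ∫ y, id y ∂(gauss θ (σ ^ 2)) = θ := by simp [gauss]
    rw [h1, h2] at hcheb
    have h3 : (gauss θ (σ ^ 2)) Aᶜ ≤ ENNReal.ofReal (1 / M ^ 2) := by
      refine (measure_mono fun x hx => ?_).trans hcheb
      show M * σ ≤ |x - θ|
      by_contra! h
      rw [abs_lt] at h
      exact hx ⟨by linarith [h.1], by linarith [h.2]⟩
    have h4 : (gauss θ (σ ^ 2)).real Aᶜ ≤ 1 / M ^ 2 :=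
      ENNReal.toReal_le_of_le_ofReal (by positivity) h3
    rw [probReal_compl_eq_one_sub measurableSet_Icc] at h4
    linarith
  have hle : ENNReal.ofReal (1 - ε) * gauss θ (σ ^ 2) A ≤ efron θ σ ε Q A := by
    simp only [efron, Measure.add_apply, Measure.smul_apply, smul_eq_mul]
    exact le_self_add
  have hr := ENNReal.toReal_mono (measure_ne_top _ _) hle
  rw [ENNReal.toReal_mul, ENNReal.toReal_ofReal (by linarith [hε.2])] at hr
  exact (mul_le_mul_of_nonneg_left hg (by linarith [hε.2])).trans hr

lemma fracNear_deviation {n : ℕ} (hn : 0 < n) {θ σ ε M c : ℝ} (hσ : 0 < σ) (hM : 0 < M)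
    (hc : 0 < c) (hε : ε ∈ Set.Icc (0 : ℝ) 1) (hcM : 1 / 2 + c ≤ (1 - ε) * (1 - 1 / M ^ 2))
    (Q : Measure ℝ) [IsProbabilityMeasure Q] :
    iid n (efron θ σ ε Q) {x | fracNear θ (M * σ) x ≤ 1 / 2}
      ≤ ENNReal.ofReal (1 / (n * c ^ 2)) := by
  have := isProbabilityMeasure_efron θ σ hε Q
  have hdev := iid_mean_deviation hn (efron θ σ ε Q)
    (f := (Set.Icc (θ - M * σ) (θ + M * σ)).indicator fun _ => (1 : ℝ))
    (measurable_const.indicator measurableSet_Icc)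
    (fun x => by simp only [Set.indicator_apply]; split_ifs <;> simp) hc
  have hmean := efron_Icc_ge (θ := θ) hσ hM hε Q
  rw [integral_indicator_const _ measurableSet_Icc, smul_eq_mul, mul_one] at hdev
  refine (measure_mono fun x hx => ?_).trans hdev
  have hx' : fracNear θ (M * σ) x ≤ 1 / 2 := hx
  show c ≤ |fracNear θ (M * σ) x - _|
  rw [abs_sub_comm]
  exact le_trans (by linarith) (le_abs_self _)

/-- A countable family of measurable constraints has a measurable selector. -/
lemma exists_measurable_selector {α : Type*} [MeasurableSpace α] {p : α → ℝ → Prop}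
    (hp : ∀ a, MeasurableSet {x | p x a}) (d : ℕ → ℝ) :
    ∃ g : α → ℝ, Measurable g ∧ ∀ x, (∃ k, p x (d k)) → p x (g x) := by
  classical
  have hex : ∀ x, ∃ k, p x (d k) ∨ ∀ j, ¬ p x (d j) := by
    intro x
    by_cases h : ∃ k, p x (d k)
    · exact h.imp fun k hk => Or.inl hk
    · exact ⟨0, Or.inr (not_exists.1 h)⟩
  refine ⟨fun x => d (Nat.find (hex x)), ?_, fun x ⟨k, hk⟩ => ?_⟩
  · refine (measurable_from_nat (f := d)).comp (measurable_find hex fun k => ?_)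
    have : {x | p x (d k) ∨ ∀ j, ¬ p x (d j)} = {x | p x (d k)} ∪ ⋂ j, {x | p x (d j)}ᶜ := by
      ext x; simp
    rw [this]
    exact (hp _).union (MeasurableSet.iInter fun j => (hp _).compl)
  · exact (Nat.find_spec (hex x)).resolve_right fun h => h k hk

lemma norm_cexp_sub_cexp (a b : ℝ) :
    ‖Complex.exp (a * Complex.I) - Complex.exp (b * Complex.I)‖ = 2 * |Real.sin ((a - b) / 2)| := by
  have h : Complex.exp (a * Complex.I) - Complex.exp (b * Complex.I)
      = Complex.exp (b * Complex.I) * (Complex.exp (Complex.I * ((a - b : ℝ) : ℂ)) - 1) := by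
    rw [mul_sub, ← Complex.exp_add, mul_one]
    congr 2
    push_cast
    ring
  rw [h, norm_mul, Complex.norm_exp_ofReal_mul_I, one_mul, Complex.norm_exp_I_mul_ofReal_sub_one]
  simp

lemma norm_mix_sub_sq_le {e v : ℂ} {ε : ℝ} (hε0 : 0 ≤ ε) (hε : ε ≤ 1 / 2) (he : ‖e‖ = 1)
    (hv : ‖v‖ ≤ 1) :
    ‖(1 - ε) * e + ε * v - e‖ ^ 2 ≤ 1 - ‖(1 - ε) * e + ε * v‖ ^ 2 := by
  have he' : e.re * e.re + e.im * e.im = 1 := by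
    rw [← Complex.normSq_apply, Complex.normSq_eq_norm_sq, he]; norm_num
  have hv' : v.re * v.re + v.im * v.im ≤ 1 := by
    rw [← Complex.normSq_apply, Complex.normSq_eq_norm_sq]; nlinarith [norm_nonneg v]
  have hre : ((1 - ε) * e + ε * v : ℂ).re = (1 - ε) * e.re + ε * v.re := by simp
  have him : ((1 - ε) * e + ε * v : ℂ).im = (1 - ε) * e.im + ε * v.im := by simp
  rw [← Complex.normSq_eq_norm_sq, ← Complex.normSq_eq_norm_sq, Complex.normSq_apply,
    Complex.normSq_apply, Complex.sub_re, Complex.sub_im, hre, him]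
  have key : 1 - (((1 - ε) * e.re + ε * v.re) ^ 2 + ((1 - ε) * e.im + ε * v.im) ^ 2)
      - ε ^ 2 * ((v.re - e.re) ^ 2 + (v.im - e.im) ^ 2)
      = ε * (1 - (v.re * v.re + v.im * v.im))
        + ε * (1 - 2 * ε) * ((v.re - e.re) ^ 2 + (v.im - e.im) ^ 2)
        + (1 - ε) * (1 - (e.re * e.re + e.im * e.im)) := by ring
  have h1 : 0 ≤ ε * (1 - (v.re * v.re + v.im * v.im)) := mul_nonneg hε0 (by linarith)
  have h2 : 0 ≤ ε * (1 - 2 * ε) * ((v.re - e.re) ^ 2 + (v.im - e.im) ^ 2) :=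
    mul_nonneg (mul_nonneg hε0 (by linarith)) (by positivity)
  rw [he', sub_self, mul_zero, add_zero] at key
  nlinarith

/-- A noisy observation `z` of the mixture `(1-ε)e + εv` is close to `e`, both absolutely and
relative to its own distance from the unit circle. -/
lemma noisy_mix_bounds {e v z : ℂ} {ε ν : ℝ} (hε0 : 0 ≤ ε) (hε : ε ≤ 1 / 2) (he : ‖e‖ = 1)
    (hv : ‖v‖ ≤ 1) (hν0 : 0 < ν) (hν : ν ≤ 1) (hz : ‖z - ((1 - ε) * e + ε * v)‖ ≤ ν) :
    ‖e - z‖ < 2 * ε + 2 * ν ∧ ‖e - z‖ ^ 2 < 2 * (1 - ‖z‖ ^ 2) + 9 * ν ∧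
      2 * (1 - ‖z‖ ^ 2) + 9 * ν ≤ 8 * ε + 15 * ν := by
  set ψ : ℂ := (1 - ε) * e + ε * v with hψ
  have hsq : ‖ψ - e‖ ^ 2 ≤ 1 - ‖ψ‖ ^ 2 := norm_mix_sub_sq_le hε0 hε he hv
  have hψe : ‖ψ - e‖ ≤ 2 * ε := by
    have : ψ - e = ε * (v - e) := by rw [hψ]; ring
    rw [this, norm_mul, Complex.norm_real, Real.norm_of_nonneg hε0]
    have : ‖v - e‖ ≤ 2 := (norm_sub_le _ _).trans (by linarith)
    nlinarith
  have hψ1 : ‖ψ‖ ≤ 1 := by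
    have := sq_nonneg ‖ψ - e‖
    nlinarith [norm_nonneg ψ]
  have hψ2 : 1 - 2 * ε ≤ ‖ψ‖ := by
    have := norm_sub_norm_le e ψ
    rw [norm_sub_rev e ψ] at this
    linarith
  have hez : ‖e - z‖ ≤ ‖ψ - e‖ + ν := by
    have : e - z = -(ψ - e) - (z - ψ) := by ring
    rw [this]
    exact (norm_sub_le _ _).trans (by rw [norm_neg]; linarith)
  have hzψ : ‖z‖ ≤ ‖ψ‖ + ν := by
    have := norm_sub_norm_le z ψ; linarith
  have hψz : ‖ψ‖ ≤ ‖z‖ + ν := by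
    have := norm_sub_norm_le ψ z
    rw [norm_sub_rev] at this; linarith
  have hz2 : ‖z‖ ^ 2 ≤ ‖ψ‖ ^ 2 + 2 * ν + ν ^ 2 := by
    nlinarith [norm_nonneg z, norm_nonneg ψ]
  have hψz2 : ‖ψ‖ ^ 2 ≤ ‖z‖ ^ 2 + 3 * ν := by
    nlinarith [norm_nonneg z, norm_nonneg ψ]
  refine ⟨by linarith, ?_, ?_⟩
  · have h1 : ‖e - z‖ ^ 2 ≤ 2 * ‖ψ - e‖ ^ 2 + 2 * ν ^ 2 := by
      nlinarith [norm_nonneg (e - z), norm_nonneg (ψ - e), sq_nonneg (‖ψ - e‖ - ν)]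
    nlinarith
  · nlinarith [norm_nonneg ψ]

lemma exists_ratio {s : ℝ} (hs0 : 0 < s) (hs : s < 1) :
    ∃ ρ : ℝ, 1 < ρ ∧ ∀ y ∈ Set.Icc 0 (π / 2), Real.sin y ≤ s → ρ * y ≤ π / 2 := by
  have hβ0 : 0 < Real.arcsin s := Real.arcsin_pos.2 hs0
  have hβ : Real.arcsin s < π / 2 := Real.arcsin_lt_pi_div_two.2 hs
  refine ⟨π / 2 / Real.arcsin s, (one_lt_div hβ0).2 hβ, fun y hy hsin => ?_⟩
  have hy' : y ≤ Real.arcsin s :=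
    (Real.le_arcsin_iff_sin_le' ⟨by linarith [hy.1, pi_pos], hy.2⟩).2 hsin
  calc π / 2 / Real.arcsin s * y ≤ π / 2 / Real.arcsin s * Real.arcsin s := by
        gcongr
    _ = π / 2 := by field_simp

/-- Localization along a geometric grid of frequencies: no aliasing occurs as long as every chord
stays below `s`. -/
lemma grid_mul_le_half_pi {s ρ y : ℝ} (hρ0 : 0 ≤ ρ)
    (hρ : ∀ y ∈ Set.Icc 0 (π / 2), Real.sin y ≤ s → ρ * y ≤ π / 2)
    (hy0 : 0 ≤ y) (hy : y ≤ π / 2) (k : ℕ) (h : ∀ j < k, Real.sin (ρ ^ j * y) ≤ s) :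
    ρ ^ k * y ≤ π / 2 := by
  induction k with
  | zero => simpa using hy
  | succ k ih =>
    rw [pow_succ', mul_assoc]
    exact hρ _ ⟨by positivity, ih fun j hj => h j (hj.trans k.lt_succ_self)⟩
      (h k k.lt_succ_self)

lemma exists_noise_scale {t₀ ρ τ : ℝ} (ht₀ : 0 < t₀) (hρ : 1 < ρ) (hτ : 0 < τ) :
    ∃ A : ℝ, 0 < A ∧ ∀ V : Finset ℕ,
      ∑ k ∈ V, 8 * Real.exp (-(t₀ * ρ ^ k) ^ 2) / A ^ 2 ≤ τ := by
  have hsum : Summable fun k : ℕ => Real.exp (-(t₀ * ρ ^ k) ^ 2) := by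
    have hg : Summable fun k : ℕ => (1 / t₀ ^ 2) * ((ρ ^ 2)⁻¹) ^ k :=
      (summable_geometric_of_lt_one (by positivity)
        (inv_lt_one_of_one_lt₀ (by nlinarith))).mul_left _
    refine Summable.of_nonneg_of_le (fun k => (Real.exp_pos _).le) (fun k => ?_) hg
    have hpos : 0 < (t₀ * ρ ^ k) ^ 2 := by positivity
    have h1 := Real.add_one_le_exp ((t₀ * ρ ^ k) ^ 2)
    have h2 : (1 / t₀ ^ 2) * ((ρ ^ 2)⁻¹) ^ k = ((t₀ * ρ ^ k) ^ 2)⁻¹ := by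
      rw [mul_pow, mul_inv, one_div, inv_pow, ← pow_mul, ← pow_mul, mul_comm 2 k]
    rw [h2, Real.exp_neg]
    exact inv_anti₀ hpos (by linarith)
  set S := ∑' k : ℕ, Real.exp (-(t₀ * ρ ^ k) ^ 2) with hS
  have hS0 : 0 < S := hsum.tsum_pos (fun k => (Real.exp_pos _).le) 0 (Real.exp_pos _)
  refine ⟨Real.sqrt (8 * S / τ), by positivity, fun V => ?_⟩
  have hV : ∑ k ∈ V, Real.exp (-(t₀ * ρ ^ k) ^ 2) ≤ S :=
    hsum.sum_le_tsum V fun k _ => (Real.exp_pos _).le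
  rw [← Finset.sum_div, ← Finset.mul_sum, Real.sq_sqrt (by positivity), div_le_iff₀ (by positivity)]
  calc _ ≤ 8 * S := by gcongr
    _ = _ := by field_simp

/-- Along the frequency grid `t₀ρᵏ` some admissible frequency attains the target rate. -/
lemma exists_frequency_rate {t₀ ρ A η : ℝ} (ht₀ : 0 < t₀) (hρ : 1 < ρ) (hA : 0 < A)
    (hη : 0 < η) (hη1 : η ≤ 1) :
    ∃ C : ℝ, 0 < C ∧ ∀ (n : ℕ) (ε : ℝ), 0 < n → A * Real.exp (t₀ ^ 2) / Real.sqrt n ≤ η →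
      0 ≤ ε → ε ≤ 1 → ∃ k : ℕ,
        A * Real.exp ((t₀ * ρ ^ k) ^ 2) / Real.sqrt n ≤ η ∧
        Real.sqrt (8 * ε + 15 * (A * Real.exp ((t₀ * ρ ^ k) ^ 2) / Real.sqrt n)) / (t₀ * ρ ^ k)
          ≤ C * ((n : ℝ) ^ (-(1/4 : ℝ)) + ε ^ ((1:ℝ)/2) /
            Real.sqrt (max 1 (Real.log (Real.exp 1 * n * ε ^ 2)))) := by
  set L₀ : ℝ := max 1 (max (4 * t₀ ^ 2) (4 * (1 / 2 + Real.log (A / η)))) with hL₀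
  have hL₀1 : 1 ≤ L₀ := le_max_left _ _
  have hL₀2 : 4 * t₀ ^ 2 ≤ L₀ := (le_max_left _ _).trans (le_max_right _ _)
  have hL₀3 : 4 * (1 / 2 + Real.log (A / η)) ≤ L₀ := (le_max_right _ _).trans (le_max_right _ _)
  set a : ℝ := Real.sqrt (A * Real.exp (t₀ ^ 2)) with ha
  have ha0 : 0 < a := by positivity
  have hL₀p : 0 < Real.sqrt L₀ := by positivity
  refine ⟨(3 * Real.sqrt L₀ + 4 * a) / t₀ + 10 * ρ, by positivity, fun n ε hn hν₀ hε hε1 => ?_⟩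
  have hn' : (0 : ℝ) < n := by exact_mod_cast hn
  rw [← Real.sqrt_eq_rpow]
  set L : ℝ := max 1 (Real.log (Real.exp 1 * n * ε ^ 2)) with hL
  have hL1 : 1 ≤ L := le_max_left _ _
  have hLp : 0 < Real.sqrt L := by positivity
  have hq : 0 < (n : ℝ) ^ (-(1/4 : ℝ)) := by positivity
  have hr : 0 ≤ Real.sqrt ε / Real.sqrt L := by positivity
  rcases le_or_gt L L₀ with hcase | hcase
  · refine ⟨0, by simpa using hν₀, ?_⟩
    simp only [pow_zero, mul_one]
    have hsplit : Real.sqrt (8 * ε + 15 * (A * Real.exp (t₀ ^ 2) / Real.sqrt n))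
        ≤ 3 * Real.sqrt ε + 4 * (a * (n : ℝ) ^ (-(1/4 : ℝ))) := by
      have hq2 : ((n : ℝ) ^ (-(1/4 : ℝ))) ^ 2 = 1 / Real.sqrt n := by
        rw [← Real.rpow_natCast, ← Real.rpow_mul hn'.le, Real.sqrt_eq_rpow,
          one_div ((n : ℝ) ^ (1 / 2 : ℝ)), ← Real.rpow_neg hn'.le]
        norm_num
      apply Real.sqrt_le_iff.2 ⟨by positivity, ?_⟩
      have h1 : (3 * Real.sqrt ε + 4 * (a * (n : ℝ) ^ (-(1/4 : ℝ)))) ^ 2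
          = 9 * Real.sqrt ε ^ 2 + 16 * (a ^ 2 * ((n : ℝ) ^ (-(1/4 : ℝ))) ^ 2)
            + 24 * (Real.sqrt ε * (a * (n : ℝ) ^ (-(1/4 : ℝ)))) := by ring
      rw [h1, hq2, Real.sq_sqrt hε, ha, Real.sq_sqrt (by positivity), ← ha, mul_one_div]
      have h2 : 0 ≤ Real.sqrt ε * (a * (n : ℝ) ^ (-(1/4 : ℝ))) := by positivity
      have h3 : 0 ≤ A * Real.exp (t₀ ^ 2) / Real.sqrt n := by positivity
      linarith
    have hε' : Real.sqrt ε ≤ Real.sqrt L₀ * (Real.sqrt ε / Real.sqrt L) := by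
      rw [mul_div_assoc', le_div_iff₀ hLp, mul_comm]
      gcongr
    calc _ ≤ (3 * (Real.sqrt L₀ * (Real.sqrt ε / Real.sqrt L))
            + 4 * (a * (n : ℝ) ^ (-(1/4 : ℝ)))) / t₀ := by
          gcongr
          linarith
      _ = (3 * Real.sqrt L₀) / t₀ * (Real.sqrt ε / Real.sqrt L)
            + 4 * a / t₀ * (n : ℝ) ^ (-(1/4 : ℝ)) := by ring
      _ ≤ ((3 * Real.sqrt L₀ + 4 * a) / t₀ + 10 * ρ) * (Real.sqrt ε / Real.sqrt L)
            + ((3 * Real.sqrt L₀ + 4 * a) / t₀ + 10 * ρ) * (n : ℝ) ^ (-(1/4 : ℝ)) := by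
          gcongr
          · rw [add_div]
            have : 0 ≤ 4 * a / t₀ := by positivity
            linarith
          · rw [add_div]
            have : 0 ≤ 3 * Real.sqrt L₀ / t₀ := by positivity
            linarith
      _ = _ := by ring
  · have hLlog : L = Real.log (Real.exp 1 * n * ε ^ 2) := by
      rcases le_total (Real.log (Real.exp 1 * n * ε ^ 2)) 1 with h | h
      · rw [hL, max_eq_left h] at hcase; linarith
      · rw [hL, max_eq_right h]
    have hε0 : 0 < ε := by
      rcases hε.eq_or_lt with h | h
      · rw [hLlog, ← h] at hcase
        norm_num at hcase
        linarith
      · exact h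
    have hεn : Real.exp ((L - 1) / 2) = Real.sqrt n * ε := by
      have h1 : Real.exp (L - 1) = (Real.sqrt n * ε) ^ 2 := by
        rw [mul_pow, Real.sq_sqrt hn'.le, Real.exp_sub, hLlog, Real.exp_log (by positivity)]
        field_simp
      rw [Real.exp_half, h1, Real.sqrt_sq (by positivity)]
    have hx : 1 ≤ Real.sqrt L / (2 * t₀) := by
      rw [le_div_iff₀ (by positivity)]
      apply Real.le_sqrt_of_sq_le
      nlinarith
    obtain ⟨k, hk1, hk2⟩ := exists_nat_pow_near hx hρ
    have htk0 : 0 < t₀ * ρ ^ k := by positivity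
    have htk : t₀ * ρ ^ k ≤ Real.sqrt L / 2 := by
      rw [le_div_iff₀ (by positivity)] at hk1
      linarith
    have htk' : Real.sqrt L / 2 ≤ ρ * (t₀ * ρ ^ k) := by
      rw [div_lt_iff₀ (by positivity), pow_succ] at hk2
      linarith
    have hν : A * Real.exp ((t₀ * ρ ^ k) ^ 2) / Real.sqrt n ≤ η * ε := by
      have h1 : (t₀ * ρ ^ k) ^ 2 ≤ L / 4 := by
        calc _ ≤ (Real.sqrt L / 2) ^ 2 := by gcongr
          _ = _ := by rw [div_pow, Real.sq_sqrt (by positivity)]; norm_num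
      have h2 : A / η ≤ Real.exp (L / 4 - 1 / 2) := by
        rw [← Real.log_le_iff_le_exp (by positivity)]
        linarith
      rw [div_le_iff₀ (by positivity)]
      calc A * Real.exp ((t₀ * ρ ^ k) ^ 2) = η * (A / η * Real.exp ((t₀ * ρ ^ k) ^ 2)) := by
            field_simp
        _ ≤ η * (Real.exp (L / 4 - 1 / 2) * Real.exp (L / 4)) := by gcongr
        _ = η * Real.exp ((L - 1) / 2) := by rw [← Real.exp_add]; ring_nf
        _ = η * ε * Real.sqrt n := by rw [hεn]; ring
    refine ⟨k, hν.trans (by nlinarith), ?_⟩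
    have hs : Real.sqrt (8 * ε + 15 * (A * Real.exp ((t₀ * ρ ^ k) ^ 2) / Real.sqrt n))
        ≤ 5 * Real.sqrt ε := by
      apply Real.sqrt_le_iff.2 ⟨by positivity, ?_⟩
      rw [mul_pow 5, Real.sq_sqrt hε]
      nlinarith
    rw [div_le_iff₀ htk0]
    calc _ ≤ 5 * Real.sqrt ε := hs
      _ = 10 * (Real.sqrt ε / Real.sqrt L) * (Real.sqrt L / 2) := by field_simp; norm_num
      _ ≤ 10 * (Real.sqrt ε / Real.sqrt L) * (ρ * (t₀ * ρ ^ k)) := by gcongr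
      _ = 10 * ρ * (Real.sqrt ε / Real.sqrt L) * (t₀ * ρ ^ k) := by ring
      _ ≤ _ := by
        gcongr
        · have : 0 ≤ (3 * Real.sqrt L₀ + 4 * a) / t₀ := by positivity
          linarith
        · linarith

/-- The empirical characteristic function at frequency `t/σ` with the Gaussian factor removed. -/
noncomputable def deconvCF {n : ℕ} (σ t : ℝ) (x : Fin n → ℝ) : ℂ :=
  Real.exp (t ^ 2 / 2) * empCharFun (t / σ) x

lemma measurable_deconvCF {n : ℕ} (σ t : ℝ) : Measurable (deconvCF (n := n) σ t) :=
  (measurable_empCharFun _).const_mul _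

lemma deconvCF_deviation {n : ℕ} (hn : 0 < n) {θ σ ε ν : ℝ} (hσ : 0 < σ) (hν : 0 < ν)
    (hε : ε ∈ Set.Icc (0 : ℝ) 1) (Q : Measure ℝ) [IsProbabilityMeasure Q] (t : ℝ) :
    iid n (efron θ σ ε Q) {x | ν < ‖deconvCF σ t x - mixCharFun θ ε Q (t / σ)‖}
      ≤ ENNReal.ofReal (8 * Real.exp (t ^ 2) / (n * ν ^ 2)) := by
  have := isProbabilityMeasure_efron θ σ hε Q
  have hdev := empCharFun_deviation hn (efron θ σ ε Q) (t / σ) (c := ν * Real.exp (-(t ^ 2 / 2)))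
    (by positivity)
  have hsq : Real.exp (-(t ^ 2 / 2)) ^ 2 * Real.exp (t ^ 2) = 1 := by
    rw [← Real.exp_nat_mul, ← Real.exp_add, ← Real.exp_zero]
    congr 1
    push_cast
    ring
  have hn' : (n : ℝ) ≠ 0 := by exact_mod_cast hn.ne'
  have hbound : 8 / (n * (ν * Real.exp (-(t ^ 2 / 2))) ^ 2)
      = 8 * Real.exp (t ^ 2) / (n * ν ^ 2) := by
    rw [div_eq_div_iff (by positivity) (by positivity), mul_pow]
    linear_combination -8 * n * ν ^ 2 * hsq
  rw [hbound] at hdev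
  refine (measure_mono fun x hx => ?_).trans hdev
  have hx' : ν < ‖deconvCF σ t x - mixCharFun θ ε Q (t / σ)‖ := hx
  show ν * Real.exp (-(t ^ 2 / 2)) ≤ ‖empCharFun (t / σ) x - charFun (efron θ σ ε Q) (t / σ)‖
  have hfac : empCharFun (t / σ) x - charFun (efron θ σ ε Q) (t / σ)
      = (Real.exp (-(t ^ 2 / 2)) : ℝ) * (deconvCF σ t x - mixCharFun θ ε Q (t / σ)) := by
    have h1 : σ ^ 2 * (t / σ) ^ 2 / 2 = t ^ 2 / 2 := by field_simp
    have h2 : ((Real.exp (-(t ^ 2 / 2)) : ℝ) : ℂ) * ((Real.exp (t ^ 2 / 2) : ℝ) : ℂ) = 1 := by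
      rw [← Complex.ofReal_mul, ← Real.exp_add]
      simp
    rw [charFun_efron hε, h1, deconvCF]
    linear_combination (-empCharFun (t / σ) x) * h2
  rw [hfac, norm_mul, Complex.norm_real, Real.norm_of_nonneg (Real.exp_pos _).le, mul_comm]
  gcongr

/-- Squared chord allowance at noise level `ν`. -/
noncomputable def chordBound {n : ℕ} (σ t ν : ℝ) (x : Fin n → ℝ) : ℝ :=
  2 * (1 - ‖deconvCF σ t x‖ ^ 2) + 9 * ν

lemma measurable_chordBound {n : ℕ} (σ t ν : ℝ) : Measurable (chordBound (n := n) σ t ν) :=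
  ((measurable_const.sub ((measurable_deconvCF σ t).norm.pow_const 2)).const_mul 2).add_const _

/-- The location `a` is consistent with the sample: it is close to most of the data, and all
admissible deconvolved frequencies agree with a dominant atom at `a`. -/
def Consistent {n : ℕ} (εm σ r : ℝ) (t ν : ℕ → ℝ) (V : Finset ℕ) (x : Fin n → ℝ) (a : ℝ) : Prop :=
  1 / 2 < fracNear a r x ∧ ∀ k ∈ V,
    ‖Complex.exp ((t k / σ * a : ℝ) * Complex.I) - deconvCF σ (t k) x‖ < 2 * εm + 2 * ν k ∧
    ‖Complex.exp ((t k / σ * a : ℝ) * Complex.I) - deconvCF σ (t k) x‖ ^ 2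
      < chordBound σ (t k) (ν k) x

lemma measurableSet_consistent {n : ℕ} (εm σ r : ℝ) (t ν : ℕ → ℝ) (V : Finset ℕ) (a : ℝ) :
    MeasurableSet {x : Fin n → ℝ | Consistent εm σ r t ν V x a} := by
  have hnorm : ∀ k, Measurable fun x : Fin n → ℝ =>
      ‖Complex.exp ((t k / σ * a : ℝ) * Complex.I) - deconvCF σ (t k) x‖ := fun k =>
    (measurable_const.sub (measurable_deconvCF σ (t k))).norm
  have heq : {x : Fin n → ℝ | Consistent εm σ r t ν V x a} =
      {x | 1 / 2 < fracNear a r x} ∩ ⋂ k ∈ V,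
        ({x | ‖Complex.exp ((t k / σ * a : ℝ) * Complex.I) - deconvCF σ (t k) x‖
            < 2 * εm + 2 * ν k} ∩
          {x | ‖Complex.exp ((t k / σ * a : ℝ) * Complex.I) - deconvCF σ (t k) x‖ ^ 2
            < chordBound σ (t k) (ν k) x}) := by
    ext x
    simp [Consistent]
  rw [heq]
  exact (measurableSet_lt measurable_const (measurable_fracNear a r)).inter
    (Finset.measurableSet_biInter V fun k _ =>
      (measurableSet_lt (hnorm k) measurable_const).inter
        (measurableSet_lt ((hnorm k).pow_const 2) (measurable_chordBound _ _ _)))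

/-- On the event that all deconvolved frequencies are accurate, the true location has consistent
points arbitrarily close to it; in particular some member of a dense sequence is consistent. -/
lemma exists_consistent_of_denseRange {n : ℕ} {θ σ ε εm r : ℝ} {t ν : ℕ → ℝ} {V : Finset ℕ}
    {Q : Measure ℝ} [IsProbabilityMeasure Q] {x : Fin n → ℝ} {d : ℕ → ℝ} (hd : DenseRange d)
    (hσ : 0 < σ) (hε : ε ∈ Set.Icc 0 εm) (hεm : εm ≤ 1 / 2)
    (hν : ∀ k ∈ V, 0 < ν k ∧ ν k ≤ 1) (hx : 1 / 2 < fracNear θ r x)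
    (hdev : ∀ k ∈ V, ‖deconvCF σ (t k) x - mixCharFun θ ε Q (t k / σ)‖ ≤ ν k) :
    (∀ k ∈ V,
      ‖Complex.exp ((t k / σ * θ : ℝ) * Complex.I) - deconvCF σ (t k) x‖ < 2 * εm + 2 * ν k ∧
      ‖Complex.exp ((t k / σ * θ : ℝ) * Complex.I) - deconvCF σ (t k) x‖ ^ 2
        < chordBound σ (t k) (ν k) x ∧
      chordBound σ (t k) (ν k) x ≤ 8 * ε + 15 * ν k) ∧
    ∃ j, Consistent εm σ (r + σ) t ν V x (d j) := by
  have htrue : ∀ k ∈ V,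
      ‖Complex.exp ((t k / σ * θ : ℝ) * Complex.I) - deconvCF σ (t k) x‖ < 2 * εm + 2 * ν k ∧
      ‖Complex.exp ((t k / σ * θ : ℝ) * Complex.I) - deconvCF σ (t k) x‖ ^ 2
        < chordBound σ (t k) (ν k) x ∧
      chordBound σ (t k) (ν k) x ≤ 8 * ε + 15 * ν k := by
    intro k hk
    have hdk := hdev k hk
    rw [mixCharFun, ← Complex.ofReal_mul] at hdk
    obtain ⟨h1, h2, h3⟩ := noisy_mix_bounds hε.1 (hε.2.trans hεm)
      (Complex.norm_exp_ofReal_mul_I _) (norm_charFun_le_one _) (hν k hk).1 (hν k hk).2 hdk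
    exact ⟨h1.trans_le (by linarith [hε.2]), h2, h3⟩
  refine ⟨htrue, ?_⟩
  have hcont : ∀ k, Continuous fun a : ℝ =>
      ‖Complex.exp ((t k / σ * a : ℝ) * Complex.I) - deconvCF σ (t k) x‖ := fun k => by fun_prop
  have hnear : ∀ᶠ a in nhds θ, Consistent εm σ (r + σ) t ν V x a := by
    have h1 : ∀ᶠ a in nhds θ, |θ - a| ≤ σ := by
      filter_upwards [Metric.ball_mem_nhds θ hσ] with a ha
      rw [Metric.mem_ball, dist_comm, Real.dist_eq] at ha
      exact ha.le
    have h2 : ∀ᶠ a in nhds θ, ∀ k ∈ V,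
        ‖Complex.exp ((t k / σ * a : ℝ) * Complex.I) - deconvCF σ (t k) x‖ < 2 * εm + 2 * ν k ∧
        ‖Complex.exp ((t k / σ * a : ℝ) * Complex.I) - deconvCF σ (t k) x‖ ^ 2
          < chordBound σ (t k) (ν k) x := by
      rw [Filter.eventually_all_finset]
      intro k hk
      exact ((hcont k).continuousAt.eventually_lt continuousAt_const (htrue k hk).1).and
        (((hcont k).pow 2).continuousAt.eventually_lt continuousAt_const (htrue k hk).2.1)
    filter_upwards [h1, h2] with a ha1 ha2
    exact ⟨hx.trans_le (fracNear_mono (by linarith) x), ha2⟩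
  obtain ⟨U, hU, hUo, hθU⟩ := eventually_nhds_iff.1 hnear
  obtain ⟨j, hj⟩ := hd.exists_mem_open hUo ⟨θ, hθU⟩
  exact ⟨j, hU _ hj⟩

/-- Two locations whose chords to the deconvolved frequencies are controlled lie close. -/
lemma abs_sub_le_of_chord {n : ℕ} {θ a σ εm s ρ t₀ : ℝ} {ν : ℕ → ℝ} {V : Finset ℕ}
    {x : Fin n → ℝ} (hσ : 0 < σ) (ht₀ : 0 < t₀) (hρ1 : 1 < ρ)
    (hρ : ∀ y ∈ Set.Icc 0 (π / 2), Real.sin y ≤ s → ρ * y ≤ π / 2)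
    (hV : ∀ k ∈ V, ∀ j < k, j ∈ V) (hs : ∀ k ∈ V, 2 * εm + 2 * ν k ≤ s)
    (h0 : t₀ / σ * |a - θ| ≤ π)
    (ha : ∀ k ∈ V,
      ‖Complex.exp ((t₀ * ρ ^ k / σ * a : ℝ) * Complex.I) - deconvCF σ (t₀ * ρ ^ k) x‖
        < 2 * εm + 2 * ν k ∧
      ‖Complex.exp ((t₀ * ρ ^ k / σ * a : ℝ) * Complex.I) - deconvCF σ (t₀ * ρ ^ k) x‖ ^ 2
        < chordBound σ (t₀ * ρ ^ k) (ν k) x)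
    (hθ : ∀ k ∈ V,
      ‖Complex.exp ((t₀ * ρ ^ k / σ * θ : ℝ) * Complex.I) - deconvCF σ (t₀ * ρ ^ k) x‖
        < 2 * εm + 2 * ν k ∧
      ‖Complex.exp ((t₀ * ρ ^ k / σ * θ : ℝ) * Complex.I) - deconvCF σ (t₀ * ρ ^ k) x‖ ^ 2
        < chordBound σ (t₀ * ρ ^ k) (ν k) x) {k : ℕ} (hk : k ∈ V) :
    |a - θ| ≤ π * Real.sqrt (chordBound σ (t₀ * ρ ^ k) (ν k) x) / (t₀ * ρ ^ k / σ) := by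
  set y : ℝ := t₀ / σ * |a - θ| / 2 with hy
  have hy0 : 0 ≤ y := by positivity
  have hchord : ∀ j, 2 * Real.sin (ρ ^ j * y) ≤
      ‖Complex.exp ((t₀ * ρ ^ j / σ * a : ℝ) * Complex.I) - deconvCF σ (t₀ * ρ ^ j) x‖ +
      ‖Complex.exp ((t₀ * ρ ^ j / σ * θ : ℝ) * Complex.I) - deconvCF σ (t₀ * ρ ^ j) x‖ := by
    intro j
    have h1 := norm_cexp_sub_cexp (t₀ * ρ ^ j / σ * a) (t₀ * ρ ^ j / σ * θ)
    have h2 : Real.sin (ρ ^ j * y)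
        ≤ |Real.sin ((t₀ * ρ ^ j / σ * a - t₀ * ρ ^ j / σ * θ) / 2)| := by
      have h3 : ρ ^ j * y = t₀ * ρ ^ j / σ / 2 * |a - θ| := by rw [hy]; ring
      have h4 : (t₀ * ρ ^ j / σ * a - t₀ * ρ ^ j / σ * θ) / 2
          = t₀ * ρ ^ j / σ / 2 * (a - θ) := by ring
      rw [h3, h4]
      rcases abs_choice (a - θ) with h | h <;> rw [h]
      · exact le_abs_self _
      · rw [mul_neg, Real.sin_neg]
        exact neg_le_abs _
    calc _ ≤ 2 * |Real.sin ((t₀ * ρ ^ j / σ * a - t₀ * ρ ^ j / σ * θ) / 2)| := by gcongr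
      _ ≤ _ := by
        rw [← h1, norm_sub_rev (Complex.exp ((t₀ * ρ ^ j / σ * θ : ℝ) * Complex.I))
          (deconvCF σ (t₀ * ρ ^ j) x)]
        exact norm_sub_le_norm_sub_add_norm_sub _ _ _
  have hhalf : ρ ^ k * y ≤ π / 2 := by
    refine grid_mul_le_half_pi (by linarith) hρ hy0 (by rw [hy]; linarith) k fun j hj => ?_
    have hjV := hV k hk j hj
    linarith [hchord j, (ha j hjV).1, (hθ j hjV).1, hs j hjV]
  have hjordan := Real.mul_le_sin (by positivity) hhalf
  have h1 : Real.sin (ρ ^ k * y) ≤ Real.sqrt (chordBound σ (t₀ * ρ ^ k) (ν k) x) := by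
    have e1 := Real.le_sqrt_of_sq_le (ha k hk).2.le
    have e2 := Real.le_sqrt_of_sq_le (hθ k hk).2.le
    linarith [hchord k]
  rw [le_div_iff₀ (by positivity)]
  have h2 : 2 / π * (ρ ^ k * y) = |a - θ| * (t₀ * ρ ^ k / σ) / π := by
    rw [hy]; field_simp
  rw [h2] at hjordan
  have h3 := hjordan.trans h1
  rw [div_le_iff₀ pi_pos] at h3
  linarith

lemma exists_admissible_finset {t₀ ρ B : ℝ} (ht₀ : 0 < t₀) (hρ : 1 < ρ) (hB : 0 < B) (η : ℝ) :
    ∃ V : Finset ℕ, ∀ k, k ∈ V ↔ B * Real.exp ((t₀ * ρ ^ k) ^ 2) ≤ η := by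
  have h1 : Filter.Tendsto (fun k : ℕ => t₀ * ρ ^ k) Filter.atTop Filter.atTop :=
    (tendsto_pow_atTop_atTop_of_one_lt hρ).const_mul_atTop ht₀
  have h2 : Filter.Tendsto (fun k : ℕ => B * Real.exp ((t₀ * ρ ^ k) ^ 2)) Filter.atTop Filter.atTop :=
    (Real.tendsto_exp_atTop.comp ((Filter.tendsto_pow_atTop two_ne_zero).comp h1)).const_mul_atTop hB
  obtain ⟨K, hK⟩ := Filter.eventually_atTop.1 (h2.eventually_gt_atTop η)
  classical
  refine ⟨(Finset.range K).filter fun k => B * Real.exp ((t₀ * ρ ^ k) ^ 2) ≤ η, fun k => ?_⟩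
  simp only [Finset.mem_filter, Finset.mem_range, and_iff_right_iff_imp]
  intro h
  by_contra! hk
  exact (hK k hk).not_ge h

lemma one_sub_le_measure_of_compl_le {α : Type*} [MeasurableSpace α] {μ : Measure α}
    [IsProbabilityMeasure μ] {S B : Set α} {δ : ℝ} (hδ : 0 ≤ δ) (hB : μ B ≤ ENNReal.ofReal δ)
    (h : ∀ x, x ∉ B → x ∈ S) : ENNReal.ofReal (1 - δ) ≤ μ S := by
  rw [ENNReal.ofReal_sub _ hδ, ENNReal.ofReal_one, tsub_le_iff_right]
  calc (1 : ℝ≥0∞) = μ Set.univ := measure_univ.symm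
    _ ≤ μ (S ∪ B) := measure_mono fun x _ => by
        by_cases hx : x ∈ B
        · exact Or.inr hx
        · exact Or.inl (h x hx)
    _ ≤ μ S + μ B := measure_union_le _ _
    _ ≤ _ := by gcongr

/-- Known-variance upper bound (Theorem 3.1): there is a confidence-interval procedure,
adaptive to the unknown contamination proportion `ε ∈ [0, εmax]`, with coverage `1-δ` and
length at most `C·σ·(n^{-1/4} + ε^{1/2}/√(max 1 (log(e n ε²))))`. -/
theorem knownVariance_upper_bound (δ εmax : ℝ)
    (hδ : δ ∈ Set.Ioo (0:ℝ) 1) (hεm : εmax ∈ Set.Ioo (0:ℝ) (1/2)) :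
    ∃ (C : ℝ) (N : ℕ), 0 < C ∧ 1 ≤ N ∧
      ∀ n : ℕ, N ≤ n → ∀ σ : ℝ, 0 < σ →
        ∃ l u : (Fin n → ℝ) → ℝ,
          Measurable l ∧ Measurable u ∧ (∀ x, l x ≤ u x) ∧
          ∀ (θ ε : ℝ), ε ∈ Set.Icc 0 εmax →
            ∀ Q : Measure ℝ, IsProbabilityMeasure Q →
              ENNReal.ofReal (1 - δ) ≤
                iid n (efron θ σ ε Q)
                  {x | l x ≤ θ ∧ θ ≤ u x ∧
                    u x - l x ≤ C * σ * ((n : ℝ) ^ (-(1/4 : ℝ)) +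
                      ε ^ ((1:ℝ)/2) /
                        Real.sqrt (max 1 (Real.log (Real.exp 1 * n * ε ^ 2))))} := by
  obtain ⟨hδ0, hδ1⟩ := hδ
  obtain ⟨hεm0, hεm1⟩ := hεm
  obtain ⟨γ, hγ⟩ : ∃ γ : ℝ, γ = 1 / 2 - εmax := ⟨_, rfl⟩
  have hγ0 : 0 < γ := by linarith
  obtain ⟨M, hM0, hM⟩ : ∃ M : ℝ, 0 < M ∧ 1 / M ^ 2 = γ :=
    ⟨Real.sqrt (1 / γ), by positivity, by rw [Real.sq_sqrt (by positivity)]; simp⟩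
  obtain ⟨t₀, ht₀⟩ : ∃ t₀ : ℝ, t₀ = π / (2 * M + 1) := ⟨_, rfl⟩
  have ht₀p : 0 < t₀ := by rw [ht₀]; positivity
  obtain ⟨ρ, hρ1, hρ⟩ := exists_ratio (s := 1 / 2 + εmax) (by linarith) (by linarith)
  obtain ⟨A, hA, hsum⟩ := exists_noise_scale ht₀p hρ1 (half_pos hδ0)
  obtain ⟨C₀, hC₀, hrate⟩ := exists_frequency_rate ht₀p hρ1 hA (half_pos hγ0) (by linarith)
  have hc : 0 < γ * εmax := mul_pos hγ0 hεm0
  refine ⟨2 * π * C₀, max 1 (max ⌈(A * Real.exp (t₀ ^ 2) / (γ / 2)) ^ 2⌉₊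
    ⌈2 / (δ * (γ * εmax) ^ 2)⌉₊), by positivity, le_max_left _ _, fun n hn σ hσ => ?_⟩
  have hn0 : 0 < n := lt_of_lt_of_le one_pos ((le_max_left _ _).trans hn)
  have hn0' : (0 : ℝ) < n := by exact_mod_cast hn0
  have hn1 : A * Real.exp (t₀ ^ 2) / Real.sqrt n ≤ γ / 2 := by
    have h : (A * Real.exp (t₀ ^ 2) / (γ / 2)) ^ 2 ≤ n :=
      Nat.ceil_le.1 (((le_max_left _ _).trans (le_max_right _ _)).trans hn)
    rw [div_le_comm₀ (by positivity) (by positivity)]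
    exact Real.le_sqrt_of_sq_le h
  have hn2 : 1 / (n * (γ * εmax) ^ 2) ≤ δ / 2 := by
    have h : 2 / (δ * (γ * εmax) ^ 2) ≤ n :=
      Nat.ceil_le.1 (((le_max_right _ _).trans (le_max_right _ _)).trans hn)
    rw [div_le_iff₀ (by positivity)] at h ⊢
    linarith
  obtain ⟨V, hV⟩ := exists_admissible_finset ht₀p hρ1
    (show 0 < A / Real.sqrt n by positivity) (γ / 2)
  simp only [div_mul_eq_mul_div] at hV
  set t : ℕ → ℝ := fun k => t₀ * ρ ^ k with ht
  set ν : ℕ → ℝ := fun k => A * Real.exp ((t₀ * ρ ^ k) ^ 2) / Real.sqrt n with hν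
  have hVne : V.Nonempty := ⟨0, (hV 0).2 (by simpa using hn1)⟩
  have hVdown : ∀ k ∈ V, ∀ j < k, j ∈ V := by
    intro k hk j hj
    refine (hV j).2 (le_trans ?_ ((hV k).1 hk))
    have : ρ ^ j ≤ ρ ^ k := pow_le_pow_right₀ hρ1.le hj.le
    gcongr
  have hν0 : ∀ k, 0 < ν k := fun k => by positivity
  have hνγ : ∀ k ∈ V, ν k ≤ γ / 2 := fun k hk => (hV k).1 hk
  obtain ⟨g, hg, hgsel⟩ := exists_measurable_selector (α := Fin n → ℝ)
    (measurableSet_consistent εmax σ (M * σ + σ) t ν V) (TopologicalSpace.denseSeq ℝ)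
  set R : (Fin n → ℝ) → ℝ := V.inf' hVne fun k x =>
    π * Real.sqrt (chordBound σ (t k) (ν k) x) / (t k / σ) with hR
  have hRm : Measurable R :=
    Finset.inf'_induction hVne _ (fun _ hf _ hg => hf.inf hg) fun k _ =>
      ((measurable_chordBound σ (t k) (ν k)).sqrt.const_mul π).div_const _
  have hRapp : ∀ x, R x = V.inf' hVne fun k =>
      π * Real.sqrt (chordBound σ (t k) (ν k) x) / (t k / σ) := fun x => by
    rw [hR, Finset.inf'_apply]
  have ht0 : ∀ k, 0 < t k := fun k => by positivity
  refine ⟨fun x => g x - R x, fun x => g x + R x, hg.sub hRm, hg.add hRm, fun x => ?_, ?_⟩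
  · have : 0 ≤ R x := by
      rw [hRapp]
      refine Finset.le_inf' _ _ fun k _ => ?_
      have := ht0 k
      positivity
    show g x - R x ≤ g x + R x
    linarith
  intro θ ε hε Q hQ
  have hε1 : ε ∈ Set.Icc (0 : ℝ) 1 := ⟨hε.1, by linarith [hε.2]⟩
  have := isProbabilityMeasure_efron θ σ hε1 Q
  refine one_sub_le_measure_of_compl_le (B := {x | fracNear θ (M * σ) x ≤ 1 / 2} ∪
    ⋃ k ∈ V, {x | ν k < ‖deconvCF σ (t k) x - mixCharFun θ ε Q (t k / σ)‖}) hδ0.le ?_ ?_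
  · have hmed := fracNear_deviation (θ := θ) hn0 hσ hM0 hc hε1 (by
      rw [hM]
      calc 1 / 2 + γ * εmax = (1 - εmax) * (1 - γ) := by rw [hγ]; ring
        _ ≤ _ := mul_le_mul_of_nonneg_right (by linarith [hε.2]) (by linarith)) Q
    have hcf : iid n (efron θ σ ε Q)
        (⋃ k ∈ V, {x | ν k < ‖deconvCF σ (t k) x - mixCharFun θ ε Q (t k / σ)‖})
        ≤ ENNReal.ofReal (δ / 2) := by
      calc _ ≤ ∑ k ∈ V, ENNReal.ofReal (8 * Real.exp (t k ^ 2) / (n * ν k ^ 2)) :=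
            (measure_biUnion_finset_le _ _).trans (Finset.sum_le_sum fun k _ =>
              deconvCF_deviation hn0 hσ (hν0 k) hε1 Q (t k))
        _ = ENNReal.ofReal (∑ k ∈ V, 8 * Real.exp (t k ^ 2) / (n * ν k ^ 2)) :=
            (ENNReal.ofReal_sum_of_nonneg fun k _ => by positivity).symm
        _ ≤ ENNReal.ofReal (δ / 2) := by
            refine ENNReal.ofReal_le_ofReal (le_trans (le_of_eq ?_) (hsum V))
            refine Finset.sum_congr rfl fun k _ => ?_
            have h1 : n * ν k ^ 2 = A ^ 2 * Real.exp (t k ^ 2) ^ 2 := by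
              change n * (A * Real.exp (t k ^ 2) / Real.sqrt n) ^ 2 = _
              rw [div_pow, Real.sq_sqrt hn0'.le, mul_pow]
              field_simp
            have h2 := Real.exp_pos (t k ^ 2)
            change _ = 8 * Real.exp (-t k ^ 2) / A ^ 2
            rw [h1, Real.exp_neg]
            generalize Real.exp (t k ^ 2) = w at h2 ⊢
            field_simp
    calc _ ≤ ENNReal.ofReal (δ / 2) + ENNReal.ofReal (δ / 2) :=
          (measure_union_le _ _).trans
            (add_le_add (hmed.trans (ENNReal.ofReal_le_ofReal hn2)) hcf)
      _ = ENNReal.ofReal δ := by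
          rw [← ENNReal.ofReal_add (by positivity) (by positivity), add_halves]
  · intro x hx
    simp only [Set.mem_union, Set.mem_iUnion, Set.mem_ofPred_eq, not_or, not_le, not_exists,
      not_lt] at hx
    obtain ⟨hx1, hx2⟩ := hx
    obtain ⟨htrue, hsel⟩ := exists_consistent_of_denseRange
      (TopologicalSpace.denseRange_denseSeq ℝ) hσ hε hεm1.le
      (fun k hk => ⟨hν0 k, (hνγ k hk).trans (by linarith)⟩) hx1 hx2
    obtain ⟨hg1, hg2⟩ := hgsel x hsel
    have hclose : t₀ / σ * |g x - θ| ≤ π := by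
      have h := abs_sub_le_of_half_lt_fracNear hg1 hx1
      calc t₀ / σ * |g x - θ| ≤ t₀ / σ * (M * σ + σ + M * σ) := by gcongr
        _ = π := by rw [ht₀]; field_simp; ring
    have hdist : |g x - θ| ≤ R x := by
      rw [hRapp]
      refine Finset.le_inf' _ _ fun k hk => ?_
      exact abs_sub_le_of_chord hσ ht₀p hρ1 hρ hVdown
        (fun k hk => by linarith [hνγ k hk]) hclose hg2
        (fun k hk => ⟨(htrue k hk).1, (htrue k hk).2.1⟩) hk
    obtain ⟨k, hk, hkrate⟩ := hrate n ε hn0 hn1 hε1.1 hε1.2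
    have hkV : k ∈ V := (hV k).2 hk
    have hRk : R x ≤ π * σ * (C₀ * ((n : ℝ) ^ (-(1/4 : ℝ)) + ε ^ ((1:ℝ)/2) /
        Real.sqrt (max 1 (Real.log (Real.exp 1 * n * ε ^ 2))))) := by
      calc R x ≤ π * Real.sqrt (chordBound σ (t k) (ν k) x) / (t k / σ) := by
            rw [hRapp]
            exact Finset.inf'_le _ hkV
        _ = π * σ * (Real.sqrt (chordBound σ (t k) (ν k) x) / t k) := by
            have := ht0 k
            field_simp
        _ ≤ π * σ * (Real.sqrt (8 * ε + 15 * ν k) / t k) := by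
            have := ht0 k
            have := (htrue k hkV).2.2
            gcongr
        _ ≤ _ := by gcongr
    have habs := abs_le.1 hdist
    refine ⟨?_, ?_, ?_⟩
    · show g x - R x ≤ θ
      linarith [habs.2]
    · show θ ≤ g x + R x
      linarith [habs.1]
    · show g x + R x - (g x - R x) ≤ _
      linarith
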